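/- Let μ = ⊗_{i∈ℤ} μ_i be the product probability measure on {0,1}^ℤ with marginals μ_i(0) = min(1/2, 10/√(|i|+2)) = 1 − μ_i(1). Then the measure μ is non-atomic, the left shift S on ({0,1}^ℤ, μ) is nonsingular, and the shift is totally dissipative: there is a measurable wandering set W (the sets S^n W, n∈ℤ, are pairwise disjoint) whose translates cover {0,1}^ℤ up to a μ-null set. -/

import Mathlib

open MeasureTheory Filter Set Topology

/-- The cylinder set of points agreeing with `y` on the finite coordinate set `s`. -/
def cylinder {A : Type*} (s : Finset ℤ) (y : ℤ → A) : Set (ℤ → A) :=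
  {x | ∀ i ∈ s, x i = y i}

/-- `μ` is the product measure on `A^ℤ` with marginals `ρ i`. -/
def IsProductMeasure {A : Type*} [MeasurableSpace A]
    (μ : Measure (ℤ → A)) (ρ : ℤ → A → ℝ) : Prop :=
  ∀ (s : Finset ℤ) (y : ℤ → A), μ (cylinder s y) = ∏ i ∈ s, ENNReal.ofReal (ρ i (y i))

/-- The left shift on `A^ℤ`. -/
def shift {A : Type*} : (ℤ → A) → (ℤ → A) := fun x i => x (i + 1)

/-- The shift by `n` on `A^ℤ` (the `n`-th power of the left shift). -/
def shiftZ {A : Type*} (n : ℤ) : (ℤ → A) → (ℤ → A) := fun x i => x (i + n)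

/-- Two measures are equivalent if they have the same null sets. -/
def MeasEquiv {X : Type*} [MeasurableSpace X] (μ ν : Measure X) : Prop :=
  μ ≪ ν ∧ ν ≪ μ

/-- The marginal at coordinate `i` : `μ_i(0) = min(1/2, 10/√(|i|+2)) = 1 - μ_i(1)`,
with `false` playing the role of `0` and `true` the role of `1`. -/
noncomputable def krengelMarginal (i : ℤ) (b : Bool) : ℝ :=
  if b then 1 - min (1 / 2 : ℝ) (10 / Real.sqrt ((|i| : ℝ) + 2))
  else min (1 / 2 : ℝ) (10 / Real.sqrt ((|i| : ℝ) + 2))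


def kcyl (s : Finset ℤ) (b : s → Bool) : Set (ℤ → Bool) := {x | ∀ i : s, x i = b i}

lemma kcyl_meas (s : Finset ℤ) (b : s → Bool) : MeasurableSet (kcyl s b) := by
  have : kcyl s b = ⋂ i : s, (fun x : ℤ → Bool => x i) ⁻¹' {b i} := by
    ext x; simp [kcyl]
  rw [this]
  exact MeasurableSet.iInter fun i => measurable_pi_apply _ (measurableSet_singleton _)

lemma kcyl_disj (s : Finset ℤ) : Pairwise (Function.onFun Disjoint (kcyl s)) := by
  intro b c hbc
  rw [Function.onFun, Set.disjoint_left]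
  intro x hx hx'
  apply hbc
  funext i
  rw [← hx i, ← hx' i]

lemma kcyl_cover (s : Finset ℤ) : (⋃ b, kcyl s b) = univ := by
  ext x
  simp only [mem_iUnion, mem_univ, iff_true]
  exact ⟨fun i => x i, fun i => rfl⟩

lemma prod_kcyl {μ : Measure (ℤ → Bool)} {ρ : ℤ → Bool → ℝ} (h : IsProductMeasure μ ρ)
    (hρ : ∀ i b, 0 < ρ i b) (s : Finset ℤ) (b : s → Bool) :
    μ (kcyl s b) = ENNReal.ofReal (∏ i : s, ρ i (b i)) := by
  have h1 := h s (fun i => if hi : i ∈ s then b ⟨i, hi⟩ else false)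
  have h2 : cylinder s (fun i => if hi : i ∈ s then b ⟨i, hi⟩ else false) = kcyl s b := by
    ext x
    constructor
    · intro hx i
      have := hx i i.2
      simpa using this
    · intro hx i hi
      have := hx ⟨i, hi⟩
      simpa [hi] using this
  rw [← h2, h1, ← ENNReal.ofReal_prod_of_nonneg (fun i _ => (hρ _ _).le),
    ← Finset.prod_coe_sort]
  congr 1
  apply Finset.prod_congr rfl
  intro i _
  simp

lemma prob_of_prod {μ : Measure (ℤ → Bool)} {ρ : ℤ → Bool → ℝ} (h : IsProductMeasure μ ρ) :
    IsProbabilityMeasure μ := by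
  constructor
  have := h ∅ (fun _ => false)
  simpa [_root_.cylinder] using this

lemma sum_prod_kcyl (s : Finset ℤ) (f : ℤ → Bool → ℝ) :
    ∑ b : s → Bool, ∏ i : s, f i (b i) = ∏ i ∈ s, ∑ c, f i c := by
  rw [← Finset.prod_coe_sort s (fun i => ∑ c, f i c), Finset.prod_univ_sum, Fintype.piFinset_univ]

lemma prod_union {μ : Measure (ℤ → Bool)} {ρ : ℤ → Bool → ℝ} (h : IsProductMeasure μ ρ)
    (hρ : ∀ i b, 0 < ρ i b) (s : Finset ℤ) (B : Finset (s → Bool)) :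
    μ (⋃ b ∈ B, kcyl s b) = ENNReal.ofReal (∑ b ∈ B, ∏ i : s, ρ i (b i)) := by
  rw [measure_biUnion_finset (fun b _ c _ hbc => kcyl_disj s hbc) (fun b _ => kcyl_meas s b),
    ENNReal.ofReal_sum_of_nonneg (fun b _ => Finset.prod_nonneg fun i _ => (hρ _ _).le)]
  exact Finset.sum_congr rfl fun b _ => prod_kcyl h hρ s b

lemma sq_union {μ ν : Measure (ℤ → Bool)} {ρ σ : ℤ → Bool → ℝ} (h : IsProductMeasure μ ρ)
    (h' : IsProductMeasure ν σ)
    (hρ : ∀ i b, 0 < ρ i b) (hσ : ∀ i b, 0 < σ i b) (C : ℝ)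
    (hC : ∀ s : Finset ℤ, ∏ i ∈ s, ∑ b, σ i b ^ 2 / ρ i b ≤ C)
    (s : Finset ℤ) (B : Finset (s → Bool)) :
    ν (⋃ b ∈ B, kcyl s b) ^ 2 ≤ ENNReal.ofReal C * μ (⋃ b ∈ B, kcyl s b) := by
  have hC0 : 0 ≤ C := le_trans (Finset.prod_nonneg fun i _ => Finset.sum_nonneg
    fun b _ => div_nonneg (sq_nonneg _) (hρ _ _).le) (hC ∅)
  rw [prod_union h hρ, prod_union h' hσ, ← ENNReal.ofReal_mul hC0,
    ← ENNReal.ofReal_pow (Finset.sum_nonneg fun b _ => Finset.prod_nonneg fun i _ => (hσ _ _).le)]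
  apply ENNReal.ofReal_le_ofReal
  have hnn : ∀ b : s → Bool, 0 ≤ ∏ i : s, (σ i (b i) ^ 2 / ρ i (b i)) := fun b =>
    Finset.prod_nonneg fun i _ => div_nonneg (sq_nonneg _) (hρ _ _).le
  calc (∑ b ∈ B, ∏ i : s, σ i (b i)) ^ 2
      ≤ (∑ b ∈ B, ∏ i : s, (σ i (b i) ^ 2 / ρ i (b i))) * ∑ b ∈ B, ∏ i : s, ρ i (b i) := by
        apply Finset.sum_sq_le_sum_mul_sum_of_sq_le_mul
        · intro b _; exact hnn b
        · intro b _; exact Finset.prod_nonneg fun i _ => (hρ _ _).le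
        · intro b _
          apply le_of_eq
          rw [← Finset.prod_mul_distrib, ← Finset.prod_pow]
          apply Finset.prod_congr rfl
          intro i _
          rw [div_mul_cancel₀ _ (hρ _ _).ne']
    _ ≤ C * ∑ b ∈ B, ∏ i : s, ρ i (b i) := by
        apply mul_le_mul_of_nonneg_right _
          (Finset.sum_nonneg fun b _ => Finset.prod_nonneg fun i _ => (hρ _ _).le)
        calc _ ≤ ∑ b : s → Bool, ∏ i : s, (σ i (b i) ^ 2 / ρ i (b i)) :=
              Finset.sum_le_sum_of_subset_of_nonneg (Finset.subset_univ _) fun b _ _ => hnn b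
          _ = _ := sum_prod_kcyl s (fun i c => σ i c ^ 2 / ρ i c)
          _ ≤ C := hC s

lemma sq_open {μ ν : Measure (ℤ → Bool)} (C : ENNReal) 
    (hC : ∀ (s : Finset ℤ) (B : Finset (s → Bool)),
      ν (⋃ b ∈ B, kcyl s b) ^ 2 ≤ C * μ (⋃ b ∈ B, kcyl s b))
    (U : Set (ℤ → Bool)) (hU : IsOpen U) : ν U ≤ (C * μ U) ^ (1 / 2 : ℝ) := by
  classical
  let V : Finset ℤ → Set (ℤ → Bool) := fun s =>
    ⋃ b ∈ (Finset.univ.filter fun b : s → Bool => kcyl s b ⊆ U), kcyl s b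
  have hVU : ∀ s, V s ⊆ U := by
    intro s
    simp only [V, Set.iUnion_subset_iff, Finset.mem_filter]
    intro b hb
    exact hb.2
  have hV : ∀ s x, x ∈ V s ↔ kcyl s (fun i => x i) ⊆ U := by
    intro s x
    simp only [V, mem_iUnion, Finset.mem_filter, Finset.mem_univ, true_and]
    constructor
    · rintro ⟨b, hb, hx⟩
      have : b = fun i : s => x i := by funext i; exact (hx i).symm
      rw [← this]; exact hb
    · intro hx
      exact ⟨_, hx, fun i => rfl⟩
  have hmono : Monotone V := by
    intro s t hst x hx
    rw [hV] at hx ⊢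
    exact fun y hy => hx fun i => hy ⟨i, hst i.2⟩
  have hUV : U = ⋃ s, V s := by
    apply Set.Subset.antisymm _ (Set.iUnion_subset hVU)
    intro x hx
    obtain ⟨I, u, h1, h2⟩ := isOpen_pi_iff.1 hU x hx
    refine mem_iUnion.2 ⟨I, (hV I x).2 fun y hy => h2 ?_⟩
    intro i hi
    have := hy ⟨i, hi⟩
    simp only at this
    rw [this]
    exact (h1 i hi).2
  have : ν U = ⨆ s, ν (V s) := by
    conv_lhs => rw [hUV]
    exact hmono.directed_le.measure_iUnion
  rw [this]
  apply iSup_le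
  intro s
  have h1 := (hC s (Finset.univ.filter fun b : s → Bool => kcyl s b ⊆ U)).trans
    (mul_le_mul_right (measure_mono (hVU s)) C)
  have h2 : ν (V s) = (ν (V s) ^ 2) ^ (1 / 2 : ℝ) := by
    rw [← ENNReal.rpow_natCast, ← ENNReal.rpow_mul]; norm_num
  rw [h2]
  exact ENNReal.rpow_le_rpow h1 (by norm_num)

lemma ac_of_bound {μ ν : Measure (ℤ → Bool)} {ρ σ : ℤ → Bool → ℝ} (h : IsProductMeasure μ ρ)
    (h' : IsProductMeasure ν σ)
    (hρ : ∀ i b, 0 < ρ i b) (hσ : ∀ i b, 0 < σ i b) (C : ℝ)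
    (hC : ∀ s : Finset ℤ, ∏ i ∈ s, ∑ b, σ i b ^ 2 / ρ i b ≤ C) : ν ≪ μ := by
  have := prob_of_prod h
  have := prob_of_prod h'
  intro A hA
  have key : ∀ ε : ENNReal, ε ≠ 0 → ν A ≤ (ENNReal.ofReal C * ε) ^ (1 / 2 : ℝ) := by
    intro ε hε
    obtain ⟨U, hAU, hU, hlt⟩ := A.exists_isOpen_lt_of_lt (μ := μ) ε
      (by rw [hA]; exact pos_iff_ne_zero.2 hε)
    refine (measure_mono hAU).trans ((sq_open (ENNReal.ofReal C)
      (sq_union h h' hρ hσ C hC) U hU).trans ?_)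
    exact ENNReal.rpow_le_rpow (mul_le_mul_right hlt.le _) (by norm_num)
  have ht : Tendsto (fun ε : ENNReal => (ENNReal.ofReal C * ε) ^ (1 / 2 : ℝ)) (𝓝[≠] 0) (𝓝 0) := by
    have h1 : Continuous (fun ε : ENNReal => (ENNReal.ofReal C * ε) ^ (1 / 2 : ℝ)) :=
      ENNReal.continuous_rpow_const.comp (ENNReal.continuous_const_mul ENNReal.ofReal_ne_top)
    have h2 := h1.tendsto 0
    simp only [mul_zero] at h2
    rw [ENNReal.zero_rpow_of_pos (by norm_num)] at h2
    exact h2.mono_left nhdsWithin_le_nhds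
  have : (𝓝[≠] (0 : ENNReal)).NeBot := by
    refine NeBot.mono (f := 𝓝[>] (0:ENNReal)) inferInstance (nhdsWithin_mono _ fun x hx => ne_of_gt hx)
  have := ge_of_tendsto ht (eventually_nhdsWithin_of_forall fun ε hε => key ε hε)
  exact le_antisymm this bot_le

/-- Hellinger affinity bound. -/
lemma affinity_le {μ ν : Measure (ℤ → Bool)} {ρ σ : ℤ → Bool → ℝ} (h : IsProductMeasure μ ρ)
    (h' : IsProductMeasure ν σ)
    (hρ : ∀ i b, 0 < ρ i b) (hσ : ∀ i b, 0 < σ i b) (s : Finset ℤ) :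
    ∫⁻ x, (ν.rnDeriv μ x) ^ (1 / 2 : ℝ) ∂μ ≤
      ENNReal.ofReal (∏ i ∈ s, ∑ b, √(ρ i b * σ i b)) := by
  have := prob_of_prod h
  have := prob_of_prod h'
  have hone : ∀ b : s → Bool, ∫⁻ x in kcyl s b, (ν.rnDeriv μ x) ^ (1 / 2 : ℝ) ∂μ ≤
      ENNReal.ofReal (∏ i : s, √(ρ i (b i) * σ i (b i))) := by
    intro b
    have hm : Measurable fun x => (ν.rnDeriv μ x) ^ (1 / 2 : ℝ) :=
      (Measure.measurable_rnDeriv ν μ).pow_const _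
    have h1 := ENNReal.lintegral_mul_le_Lp_mul_Lq (μ.restrict (kcyl s b))
      (p := 2) (q := 2) (by constructor <;> norm_num)
      hm.aemeasurable (aemeasurable_const (b := (1 : ENNReal)))
    simp only [Pi.mul_apply, mul_one, ← ENNReal.rpow_mul, ENNReal.one_rpow] at h1
    refine h1.trans ?_
    norm_num
    have h2 : ∫⁻ x in kcyl s b, ν.rnDeriv μ x ∂μ ≤ ν (kcyl s b) :=
      Measure.setLIntegral_rnDeriv_le _
    refine (mul_le_mul_left (ENNReal.rpow_le_rpow h2 (by norm_num)) _).trans ?_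
    rw [prod_kcyl h hρ, prod_kcyl h' hσ, ENNReal.ofReal_rpow_of_pos (Finset.prod_pos fun i _ => hρ _ _),
      ENNReal.ofReal_rpow_of_pos (Finset.prod_pos fun i _ => hσ _ _),
      ← ENNReal.ofReal_mul (Real.rpow_nonneg (Finset.prod_nonneg fun i _ => (hσ _ _).le) _)]
    apply ENNReal.ofReal_le_ofReal
    rw [← Real.mul_rpow (Finset.prod_nonneg fun i _ => (hσ _ _).le)
      (Finset.prod_nonneg fun i _ => (hρ _ _).le), ← Finset.prod_mul_distrib,
      ← Real.finsetProd_rpow _ _ (fun i _ => mul_nonneg (hσ _ _).le (hρ _ _).le)]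
    apply le_of_eq
    apply Finset.prod_congr rfl
    intro i _
    rw [Real.sqrt_eq_rpow, mul_comm]
  rw [← setLIntegral_univ, ← kcyl_cover s,
    lintegral_iUnion (kcyl_meas s) (kcyl_disj s), tsum_fintype,
    ← sum_prod_kcyl s (fun i b => √(ρ i b * σ i b)),
    ENNReal.ofReal_sum_of_nonneg (fun b _ => Finset.prod_nonneg fun i _ => Real.sqrt_nonneg _)]
  exact Finset.sum_le_sum fun b _ => hone b

lemma shiftZ_meas (n : ℤ) : Measurable (shiftZ n : (ℤ → Bool) → (ℤ → Bool)) :=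
  measurable_pi_iff.2 fun i => measurable_pi_apply (i + n)

lemma shiftZ_add (m n : ℤ) (x : ℤ → Bool) : shiftZ m (shiftZ n x) = shiftZ (m + n) x := by
  funext i; simp [shiftZ, add_assoc]

lemma shiftZ_zero (x : ℤ → Bool) : shiftZ 0 x = x := by
  funext i; simp [shiftZ]

def shiftEquiv (n : ℤ) : (ℤ → Bool) ≃ᵐ (ℤ → Bool) where
  toFun := shiftZ n
  invFun := shiftZ (-n)
  left_inv x := by rw [shiftZ_add]; simp [shiftZ_zero]
  right_inv x := by rw [shiftZ_add]; simp [shiftZ_zero]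
  measurable_toFun := shiftZ_meas n
  measurable_invFun := shiftZ_meas (-n)

lemma first_argmax (g : ℤ → ENNReal) (h0 : g 0 = 1)
    (h : ∑' n, g n ^ (1 / 2 : ℝ) ≠ ⊤) :
    ∃ a, (∀ m, g m ≤ g a) ∧ (∀ m < a, g m < g a) := by
  have hF : {n | 1 ≤ g n ^ (1 / 2 : ℝ)}.Finite :=
    ENNReal.finite_const_le_of_tsum_ne_top h one_ne_zero
  have hF' : {n | 1 ≤ g n}.Finite := by
    refine hF.subset fun n hn => ?_
    exact ENNReal.one_le_rpow hn (by norm_num)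
  obtain ⟨c, hc, hmax⟩ := Set.exists_max_image _ g hF' ⟨0, h0.ge⟩
  have hmax' : ∀ m, g m ≤ g c := by
    intro m
    by_cases hm : 1 ≤ g m
    · exact hmax m hm
    · exact (not_le.1 hm).le.trans hc
  have hG : {n | g n = g c}.Finite := hF'.subset fun n hn => by
    rw [mem_ofPred_eq] at hn ⊢; rw [hn]; exact hc
  obtain ⟨a, ha, hmin⟩ := Set.exists_min_image _ id hG ⟨c, rfl⟩
  rw [mem_ofPred_eq] at ha
  refine ⟨a, fun m => ha ▸ hmax' m, fun m hm => lt_of_le_of_ne (ha ▸ hmax' m) fun he => ?_⟩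
  have := hmin m (he.trans ha)
  simp only [id] at this
  omega

lemma dissipative_of (μ : Measure (ℤ → Bool)) [IsProbabilityMeasure μ]
    (hac : ∀ n : ℤ, μ.map (shiftZ n) ≪ μ)
    (hsum : ∑' n : ℤ, ∫⁻ x, ((μ.map (shiftZ n)).rnDeriv μ x) ^ (1 / 2 : ℝ) ∂μ ≠ ⊤) :
    ∃ W : Set (ℤ → Bool), MeasurableSet W ∧
      (Pairwise fun m n : ℤ => Disjoint (shiftZ m '' W) (shiftZ n '' W)) ∧
      μ ((⋃ n : ℤ, shiftZ n '' W)ᶜ) = 0 := by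
  have hp : ∀ n : ℤ, IsProbabilityMeasure (μ.map (shiftZ n)) := fun n =>
    Measure.isProbabilityMeasure_map (shiftZ_meas n).aemeasurable
  let φ : ℤ → (ℤ → Bool) → ENNReal := fun n => (μ.map (shiftZ n)).rnDeriv μ
  have hφm : ∀ n, Measurable (φ n) := fun n => Measure.measurable_rnDeriv _ _
  have hcomp : ∀ (m : ℤ) (p : (ℤ → Bool) → Prop), (∀ᵐ x ∂μ, p x) → ∀ᵐ x ∂μ, p (shiftZ m x) :=
    fun m p h => ae_of_ae_map (shiftZ_meas m).aemeasurable ((hac m).ae_le h)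
  have hcoc : ∀ᵐ x ∂μ, ∀ m n : ℤ, φ (n + m) (shiftZ m x) = φ n x * φ m (shiftZ m x) := by
    rw [ae_all_iff]; intro m
    rw [ae_all_iff]; intro n
    have hmap : (μ.map (shiftZ n)).map (shiftZ m) = μ.map (shiftZ (n + m)) := by
      rw [Measure.map_map (shiftZ_meas m) (shiftZ_meas n)]
      congr 1
      funext x
      rw [Function.comp, shiftZ_add, add_comm]
    have h1 := (shiftEquiv m).measurableEmbedding.rnDeriv_map (μ.map (shiftZ n)) μ
    have h1' : (fun x => ((μ.map (shiftZ n)).map (shiftZ m)).rnDeriv (μ.map (shiftZ m))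
      (shiftZ m x)) =ᵐ[μ] (μ.map (shiftZ n)).rnDeriv μ := h1
    rw [hmap] at h1'
    have h2 : (μ.map (shiftZ (n + m))) ≪ μ.map (shiftZ m) := by
      rw [← hmap]
      exact (hac n).map (shiftZ_meas m)
    have h3 := hcomp m _ (Measure.rnDeriv_mul_rnDeriv (κ := μ) h2)
    filter_upwards [h1', h3] with x hx hx'
    rw [Pi.mul_apply, hx] at hx'
    exact hx'.symm
  have h0 : ∀ᵐ x ∂μ, φ 0 x = 1 := by
    have : μ.map (shiftZ 0) = μ := by
      have : (shiftZ 0 : (ℤ → Bool) → (ℤ → Bool)) = id := by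
        funext x; exact shiftZ_zero x
      rw [this, Measure.map_id]
    simp only [φ, this]
    exact Measure.rnDeriv_self μ
  have htop : ∀ᵐ x ∂μ, ∀ n, φ n x ≠ ⊤ := by
    rw [ae_all_iff]; intro n
    exact Measure.rnDeriv_ne_top _ _
  have hs : ∀ᵐ x ∂μ, ∑' n, φ n x ^ (1 / 2 : ℝ) ≠ ⊤ := by
    rw [← lintegral_tsum (fun n => ((hφm n).pow_const _).aemeasurable)] at hsum
    have := ae_lt_top (Measurable.tsum fun n => (hφm n).pow_const _) hsum
    filter_upwards [this] with x hx using hx.ne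
  have hall := hcoc.and (h0.and (htop.and hs))
  obtain ⟨X1, hX1, hX1m, hX1ae⟩ := hall.exists_measurable_mem
  let X0 : Set (ℤ → Bool) := ⋂ k : ℤ, shiftZ k ⁻¹' X1
  have hX0m : MeasurableSet X0 := MeasurableSet.iInter fun k => shiftZ_meas k hX1m
  have hX0ae : ∀ᵐ x ∂μ, x ∈ X0 := by
    simp only [X0, mem_iInter]
    rw [ae_all_iff]
    intro k
    exact hcomp k _ hX1
  have hinv : ∀ x ∈ X0, ∀ k, shiftZ k x ∈ X0 := by
    intro x hx k
    simp only [X0, mem_iInter, mem_preimage] at hx ⊢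
    intro j
    rw [shiftZ_add]
    exact hx _
  have hgood : ∀ x ∈ X0, (∀ m n : ℤ, φ (n + m) (shiftZ m x) = φ n x * φ m (shiftZ m x)) ∧
      φ 0 x = 1 ∧ (∀ n, φ n x ≠ ⊤) ∧ ∑' n, φ n x ^ (1 / 2 : ℝ) ≠ ⊤ := by
    intro x hx
    have := mem_iInter.1 hx 0
    rw [mem_preimage, shiftZ_zero] at this
    exact hX1ae x this
  refine ⟨X0 ∩ ⋂ m : ℤ, ({x | φ m x ≤ 1} ∩ {x | m < 0 → φ m x < 1}), ?_, ?_, ?_⟩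
  · refine hX0m.inter (MeasurableSet.iInter fun m => MeasurableSet.inter ?_ ?_)
    · exact measurableSet_le (hφm m) measurable_const
    · by_cases hm : m < 0
      · simp only [hm, true_imp_iff]
        exact measurableSet_lt (hφm m) measurable_const
      · simp [hm]
  · intro m n hmn
    rw [Set.disjoint_left]
    rintro y ⟨w, ⟨hw0, hw⟩, rfl⟩ ⟨w', ⟨hw0', hw'⟩, he⟩
    have hwe : shiftZ (n - m) w' = w := by
      have := congrArg (shiftZ (-m)) he
      rw [shiftZ_add, shiftZ_add] at this
      simp only [neg_add_cancel, shiftZ_zero] at this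
      rw [← this]; congr 1; ring
    have h1 := (hgood w' hw0').1 (n - m) (-(n - m))
    rw [hwe, neg_add_cancel, (hgood w hw0).2.1] at h1
    have a1 := (mem_iInter.1 hw (n - m))
    have a2 := (mem_iInter.1 hw' (-(n - m)))
    simp only [mem_inter_iff, mem_ofPred_eq] at a1 a2
    rcases lt_or_gt_of_ne hmn with hlt | hlt
    · have := a2.2 (by omega)
      have h3 : φ (-(n - m)) w' * φ (n - m) w ≤ φ (-(n - m)) w' * 1 := mul_le_mul_right a1.1 _
      rw [← h1, mul_one] at h3
      exact absurd h3 (not_le.2 this)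
    · have := a1.2 (by omega)
      have h3 : φ (-(n - m)) w' * φ (n - m) w ≤ 1 * φ (n - m) w := mul_le_mul_left a2.1 _
      rw [← h1, one_mul] at h3
      exact absurd h3 (not_le.2 this)
  · refine measure_mono_null ?_ hX0ae
    rw [Set.compl_subset_compl]
    intro x hx
    change x ∈ X0 at hx
    obtain ⟨hc, h01, ht, hss⟩ := hgood x hx
    obtain ⟨a, ha1, ha2⟩ := first_argmax (fun n => φ n x) h01 hss
    have hw0 := hinv x hx (-a)
    have hxa : shiftZ a (shiftZ (-a) x) = x := by rw [shiftZ_add]; simp [shiftZ_zero]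
    have hc' := fun n => (hgood _ hw0).1 a n
    rw [hxa] at hc'
    have hapos : φ a x ≠ 0 := by
      have := ha1 0
      rw [h01] at this
      exact (lt_of_lt_of_le zero_lt_one this).ne'
    refine mem_iUnion.2 ⟨a, shiftZ (-a) x, ⟨hw0, mem_iInter.2 fun n => ⟨?_, ?_⟩⟩, hxa⟩
    · have := ha1 (n + a)
      rw [hc' n] at this
      rw [mem_ofPred_eq]
      by_contra hlt
      rw [not_le] at hlt
      have h5 := ENNReal.mul_lt_mul_left hapos (ht a) hlt
      rw [one_mul] at h5
      exact absurd this (not_le.2 h5)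
    · intro hn
      have := ha2 (n + a) (by omega)
      rw [hc' n] at this
      by_contra hlt
      rw [not_lt] at hlt
      have h5 : 1 * φ a x ≤ φ n (shiftZ (-a) x) * φ a x := mul_le_mul_left hlt _
      rw [one_mul] at h5
      exact absurd this (not_lt.2 h5)

noncomputable def kP (i : ℤ) : ℝ := min (1 / 2 : ℝ) (10 / Real.sqrt ((|i| : ℝ) + 2))

lemma kP_true (i : ℤ) : krengelMarginal i true = 1 - kP i := by simp [krengelMarginal, kP]

lemma kP_false (i : ℤ) : krengelMarginal i false = kP i := by simp [krengelMarginal, kP]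

lemma kP_le (i : ℤ) : kP i ≤ 1 / 2 := min_le_left _ _

lemma kP_pos (i : ℤ) : 0 < kP i := by
  unfold kP
  positivity

lemma kM_pos (i : ℤ) (b : Bool) : 0 < krengelMarginal i b := by
  cases b
  · rw [kP_false]; exact kP_pos i
  · rw [kP_true]; linarith [kP_le i]

lemma kM_le (i : ℤ) (b : Bool) : krengelMarginal i b ≤ 1 - kP i := by
  cases b
  · rw [kP_false]; linarith [kP_le i]
  · rw [kP_true]

lemma kP_lower (i : ℤ) : 1 / ((|i| : ℝ) + 2) ≤ kP i := by
  have h0 : (0 : ℝ) ≤ |(i : ℝ)| := abs_nonneg _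
  unfold kP
  apply le_min
  · apply one_div_le_one_div_of_le <;> linarith
  · have h1 : 1 ≤ √(|(i : ℝ)| + 2) := Real.one_le_sqrt.2 (by linarith)
    rw [div_le_div_iff₀ (by positivity) (by positivity)]
    nlinarith [Real.sq_sqrt (show 0 ≤ |(i : ℝ)| + 2 by positivity)]

lemma kP_diff (i j : ℤ) (hij : |i - j| ≤ 1) :
    (kP j - kP i) ^ 2 ≤ 200 / ((|i| : ℝ) + 2) ^ 3 := by
  have hij' : |(i : ℝ) - j| ≤ 1 := by exact_mod_cast hij
  have h0 : (0 : ℝ) ≤ |(i : ℝ)| := abs_nonneg _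
  have h0' : (0 : ℝ) ≤ |(j : ℝ)| := abs_nonneg _
  have hd : |(|(i : ℝ)| - |(j : ℝ)|)| ≤ 1 := (abs_abs_sub_abs_le _ _).trans hij'
  set t := |(i : ℝ)| + 2 with ht
  set t' := |(j : ℝ)| + 2 with ht'
  have hd' : |t - t'| ≤ 1 := by rw [ht, ht']; simpa using hd
  have h2 : 2 ≤ t := by linarith
  have h2' : 2 ≤ t' := by linarith
  have hP : |kP j - kP i| ≤ |10 / √t' - 10 / √t| := by
    have := abs_min_sub_min_le_max (1 / 2 : ℝ) (10 / √t') (1 / 2) (10 / √t)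
    simpa [kP] using this
  have hsq : (kP j - kP i) ^ 2 ≤ (10 / √t' - 10 / √t) ^ 2 := sq_le_sq.2 hP
  refine hsq.trans ?_
  have hu : 0 < √t := by positivity
  have hv : 0 < √t' := by positivity
  have hu2 : √t ^ 2 = t := Real.sq_sqrt (by linarith)
  have hv2 : √t' ^ 2 = t' := Real.sq_sqrt (by linarith)
  have e1 : (10 / √t' - 10 / √t) ^ 2 = 100 * (√t - √t') ^ 2 / (t * t') := by
    rw [← hu2, ← hv2]
    simp only [Real.sqrt_sq hu.le, Real.sqrt_sq hv.le]
    field_simp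
    ring
  have e2 : (√t - √t') ^ 2 * t ≤ 1 := by
    have a1 : ((√t - √t') * (√t + √t')) ^ 2 ≤ 1 := by
      have : (√t - √t') * (√t + √t') = t - t' := by rw [← hu2, ← hv2]; simp only [Real.sqrt_sq hu.le, Real.sqrt_sq hv.le]; ring
      rw [this, sq_le_one_iff_abs_le_one]; exact hd'
    have a2 : t ≤ (√t + √t') ^ 2 := by nlinarith
    calc _ ≤ (√t - √t') ^ 2 * (√t + √t') ^ 2 := mul_le_mul_of_nonneg_left a2 (sq_nonneg _)
      _ = _ := by ring
      _ ≤ 1 := a1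
  rw [e1, div_le_div_iff₀ (by positivity) (by positivity)]
  have e3 : t ≤ 2 * t' := by linarith [(abs_le.1 hd').2]
  calc 100 * (√t - √t') ^ 2 * t ^ 3 = 100 * ((√t - √t') ^ 2 * t) * t ^ 2 := by ring
    _ ≤ 100 * 1 * t ^ 2 := by gcongr
    _ = 100 * t * t := by ring
    _ ≤ 100 * t * (2 * t') := by gcongr
    _ = 200 * (t * t') := by ring

lemma chi_term (i j : ℤ) (hij : |i - j| ≤ 1) :
    ∑ b, krengelMarginal j b ^ 2 / krengelMarginal i b ≤
      Real.exp (400 * (1 / ((|i| : ℝ) + 2) ^ 2)) := by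
  rw [Fintype.sum_bool, kP_true, kP_true, kP_false, kP_false]
  have h1 := kP_le i
  have h2 := kP_pos i
  have h3 := kP_lower i
  have h4 := kP_diff i j hij
  have h0 : (0 : ℝ) ≤ |(i : ℝ)| := abs_nonneg _
  set t := |(i : ℝ)| + 2 with ht
  have htp : 0 < t := by linarith
  set p := kP i
  set q := kP j
  have h5 : 0 < 1 - p := by linarith
  have e1 : (1 - q) ^ 2 / (1 - p) + q ^ 2 / p = 1 + (q - p) ^ 2 / (p * (1 - p)) := by
    field_simp; ring
  rw [e1]
  have e2 : (q - p) ^ 2 / (p * (1 - p)) ≤ 400 * (1 / t ^ 2) := by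
    rw [div_le_iff₀ (by positivity)]
    have e3 : 1 / t * (1 / 2) ≤ p * (1 - p) := mul_le_mul h3 (by linarith) (by norm_num) h2.le
    calc _ ≤ 200 / t ^ 3 := h4
      _ = 400 * (1 / t ^ 2) * (1 / t * (1 / 2)) := by field_simp; norm_num
      _ ≤ _ := by gcongr
  linarith [Real.add_one_le_exp (400 * (1 / t ^ 2))]

lemma sum_inv_sq : Summable fun i : ℤ => 1 / ((|i| : ℝ) + 2) ^ 2 := by
  have : Summable fun n : ℕ => 1 / ((n : ℝ) + 2) ^ 2 := by
    have := (summable_nat_add_iff 2).2 (Real.summable_one_div_nat_pow.2 (show 1 < 2 by norm_num))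
    simpa using this
  apply Summable.of_nat_of_neg
  · simpa using this
  · simpa using this

lemma chi_prod (d : ℤ) (hd : |d| ≤ 1) : ∃ C : ℝ, ∀ s : Finset ℤ,
    ∏ i ∈ s, ∑ b, krengelMarginal (i + d) b ^ 2 / krengelMarginal i b ≤ C := by
  refine ⟨Real.exp (∑' i : ℤ, 400 * (1 / ((|i| : ℝ) + 2) ^ 2)), fun s => ?_⟩
  calc _ ≤ ∏ i ∈ s, Real.exp (400 * (1 / ((|i| : ℝ) + 2) ^ 2)) := by
        apply Finset.prod_le_prod
        · intro i _
          exact Finset.sum_nonneg fun b _ => div_nonneg (sq_nonneg _) (kM_pos _ _).le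
        · intro i _
          exact chi_term i (i + d) (by simpa using hd)
    _ = Real.exp (∑ i ∈ s, 400 * (1 / ((|i| : ℝ) + 2) ^ 2)) := (Real.exp_sum _ _).symm
    _ ≤ _ := by
        apply Real.exp_le_exp.2
        apply (sum_inv_sq.mul_left 400).sum_le_tsum
        intro i _
        positivity

lemma shift_isProd {μ : Measure (ℤ → Bool)} {ρ : ℤ → Bool → ℝ} (h : IsProductMeasure μ ρ) (n : ℤ) :
    IsProductMeasure (μ.map (shiftZ n)) (fun i => ρ (i + n)) := by
  intro s y
  have hm : MeasurableSet (_root_.cylinder s y) := by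
    have : _root_.cylinder s y = ⋂ i ∈ s, (fun x : ℤ → Bool => x i) ⁻¹' {y i} := by
      ext x; simp [_root_.cylinder]
    rw [this]
    exact Finset.measurableSet_biInter _ fun i _ => measurable_pi_apply _ (measurableSet_singleton _)
  rw [Measure.map_apply (shiftZ_meas n) hm]
  have h1 := h (s.map (addRightEmbedding n)) (fun j => y (j - n))
  rw [Finset.prod_map] at h1
  simp only [addRightEmbedding_apply, add_sub_cancel_right] at h1
  rw [← h1]
  congr 1
  ext x
  simp [_root_.cylinder, shiftZ]

lemma krengel_ac (μ : Measure (ℤ → Bool)) (h : IsProductMeasure μ krengelMarginal) (n : ℤ) :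
    μ.map (shiftZ n) ≪ μ := by
  have h1 : ∀ d : ℤ, |d| ≤ 1 → μ.map (shiftZ d) ≪ μ := by
    intro d hd
    obtain ⟨C, hC⟩ := chi_prod d hd
    exact ac_of_bound h (shift_isProd h d) kM_pos (fun i b => kM_pos _ _) C hC
  have hmap : ∀ m n : ℤ, (μ.map (shiftZ n)).map (shiftZ m) = μ.map (shiftZ (n + m)) := by
    intro m n
    rw [Measure.map_map (shiftZ_meas m) (shiftZ_meas n)]
    congr 1
    funext x
    rw [Function.comp, shiftZ_add, add_comm]
  induction n using Int.induction_on with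
  | zero => exact h1 0 (by norm_num)
  | succ k ih =>
    rw [← hmap]
    exact (ih.map (shiftZ_meas 1)).trans (h1 1 (by norm_num))
  | pred k ih =>
    rw [sub_eq_add_neg, ← hmap]
    exact (ih.map (shiftZ_meas (-1))).trans (h1 (-1) (by norm_num))

lemma krengel_nonatomic (μ : Measure (ℤ → Bool)) (h : IsProductMeasure μ krengelMarginal)
    (x : ℤ → Bool) : μ {x} = 0 := by
  have key : ∀ n : ℕ, μ {x} ≤
      ENNReal.ofReal (Real.exp (-((1 / 2) * ∑ i ∈ Finset.range n, 1 / ((i : ℝ) + 1)))) := by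
    intro n
    have hsub : ({x} : Set (ℤ → Bool)) ⊆
        _root_.cylinder ((Finset.range n).map Nat.castEmbedding) x := by
      rintro _ rfl i _
      rfl
    refine (measure_mono hsub).trans ?_
    rw [h, ← ENNReal.ofReal_prod_of_nonneg (fun i _ => (kM_pos _ _).le), Finset.prod_map]
    apply ENNReal.ofReal_le_ofReal
    rw [Finset.mul_sum, ← Finset.sum_neg_distrib, Real.exp_sum]
    apply Finset.prod_le_prod
    · intro i _; exact (kM_pos _ _).le
    · intro i _
      refine (kM_le _ _).trans ?_
      have h1 := kP_lower (i : ℤ)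
      have h2 : 1 / 2 * (1 / ((i : ℝ) + 1)) ≤ 1 / ((|((i : ℤ) : ℝ)|) + 2) := by
        have : |((i : ℤ) : ℝ)| = (i : ℝ) := by simp
        have hi : (0 : ℝ) ≤ i := Nat.cast_nonneg i
        rw [this, one_div_mul_one_div, div_le_div_iff₀ (by positivity) (by positivity)]
        linarith
      simp only [Nat.castEmbedding_apply]
      linarith [Real.add_one_le_exp (-(1 / 2 * (1 / ((i : ℝ) + 1))))]
  have ht : Tendsto (fun n : ℕ => ENNReal.ofReal (Real.exp
      (-((1 / 2) * ∑ i ∈ Finset.range n, 1 / ((i : ℝ) + 1))))) atTop (𝓝 0) := by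
    rw [← ENNReal.ofReal_zero]
    apply ENNReal.tendsto_ofReal
    apply Real.tendsto_exp_neg_atTop_nhds_zero.comp
    exact Real.tendsto_sum_range_one_div_nat_succ_atTop.const_mul_atTop (by norm_num)
  exact le_antisymm (ge_of_tendsto' ht key) bot_le

lemma aff_term (p q : ℝ) (hp : 0 < p) (hp' : p ≤ 1 / 2) (hq : 0 < q) (hqp : 4 * q ≤ p) :
    √((1 - p) * (1 - q)) + √(p * q) ≤ Real.exp (-(p / 8)) := by
  have h1 : √((1 - p) * (1 - q)) ≤ 1 - (p + q) / 2 := by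
    apply Real.sqrt_le_iff.2
    constructor
    · linarith
    · nlinarith [sq_nonneg (p - q)]
  have h2 : √(p * q) = √p * √q := Real.sqrt_mul hp.le q
  have hu : √p ^ 2 = p := Real.sq_sqrt hp.le
  have hv : √q ^ 2 = q := Real.sq_sqrt hq.le
  have hu0 := Real.sqrt_nonneg p
  have hv0 := Real.sqrt_nonneg q
  have h3 : 2 * √q ≤ √p := by
    apply Real.le_sqrt_of_sq_le
    nlinarith
  have h4 : √p * √q ≤ (p + q) / 2 - p / 8 := by
    nlinarith [mul_nonneg (sub_nonneg.2 h3) hu0, mul_nonneg (sub_nonneg.2 h3) hv0]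
  have := Real.add_one_le_exp (-(p / 8))
  linarith

lemma aff_large (n : ℤ) (hn : 12800 ≤ (|n| : ℝ)) : ∃ s : Finset ℤ,
    ∏ i ∈ s, ∑ b, √(krengelMarginal i b * krengelMarginal (i + n) b) ≤
      10 ^ 9 * (1 / ((|n| : ℝ) + 2) ^ 2) := by
  set N : ℝ := |(n : ℝ)| with hN
  obtain ⟨K, hK1, hK2⟩ : ∃ K : ℕ, (K : ℝ) ≤ N / 64 ∧ N / 64 < K + 1 :=
    ⟨⌊N / 64⌋₊, Nat.floor_le (by positivity), Nat.lt_floor_add_one _⟩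
  let s : Finset ℤ := Finset.Icc (0 : ℤ) K
  have hcard : s.card = K + 1 := by simp [s]
  refine ⟨s, ?_⟩
  set r := √(N / 2) with hr
  have hr0 : 0 < r := by positivity
  have hr2 : r ^ 2 = N / 2 := Real.sq_sqrt (by positivity)
  have hr80 : 80 ≤ r := Real.le_sqrt_of_sq_le (by linarith)
  have hterm : ∀ i ∈ s, ∑ b, √(krengelMarginal i b * krengelMarginal (i + n) b) ≤
      Real.exp (-(5 / r)) := by
    intro i hi
    have hi' := Finset.mem_Icc.1 hi
    have hi0 : (0 : ℝ) ≤ i := by exact_mod_cast hi'.1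
    have hiK : (i : ℝ) ≤ K := by exact_mod_cast hi'.2
    have hp : 40 / r ≤ kP i := by
      apply le_min
      · rw [div_le_div_iff₀ hr0 (by norm_num)]; linarith
      · have : √(|(i : ℝ)| + 2) ≤ r / 4 := by
          apply Real.sqrt_le_iff.2
          refine ⟨by positivity, ?_⟩
          rw [abs_of_nonneg hi0, div_pow, hr2]
          linarith
        rw [div_le_div_iff₀ hr0 (by positivity)]
        linarith
    have hq : kP (i + n) ≤ 10 / r := by
      refine (min_le_right _ _).trans ?_
      apply div_le_div_of_nonneg_left (by norm_num) hr0
      apply Real.sqrt_le_sqrt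
      have : N ≤ |((i + n : ℤ) : ℝ)| + |(i : ℝ)| := by
        have := abs_sub ((i + n : ℤ) : ℝ) (i : ℝ)
        push_cast at this ⊢
        rwa [add_sub_cancel_left] at this
      rw [abs_of_nonneg hi0] at this
      linarith
    rw [Fintype.sum_bool, kP_true, kP_true, kP_false, kP_false]
    refine (aff_term (kP i) (kP (i + n)) (kP_pos _) (kP_le _) (kP_pos _) ?_).trans ?_
    · refine le_trans ?_ hp
      calc 4 * kP (i + n) ≤ 4 * (10 / r) := by gcongr
        _ = 40 / r := by ring
    · apply Real.exp_le_exp.2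
      have : 5 / r = (40 / r) / 8 := by ring
      rw [this]
      linarith
  have hx : 5 * r / 32 ≤ (K + 1 : ℝ) * (5 / r) := by
    rw [mul_div_assoc', le_div_iff₀ hr0]
    nlinarith
  have hexp : Real.exp (-((K + 1 : ℝ) * (5 / r))) ≤ 24 / (5 * r / 32) ^ 4 := by
    have h1 : (5 * r / 32) ^ 4 / 24 ≤ Real.exp (5 * r / 32) := by
      have := Real.pow_div_factorial_le_exp (5 * r / 32) (by positivity) 4
      simpa [Nat.factorial] using this
    have h2 := h1.trans (Real.exp_le_exp.2 hx)
    rw [Real.exp_neg, ← inv_div ((5 * r / 32) ^ 4) 24]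
    exact inv_anti₀ (by positivity) h2
  calc _ ≤ ∏ i ∈ s, Real.exp (-(5 / r)) :=
        Finset.prod_le_prod (fun i _ => Finset.sum_nonneg fun b _ => Real.sqrt_nonneg _) hterm
    _ = Real.exp (-((K + 1 : ℝ) * (5 / r))) := by
        rw [Finset.prod_const, hcard, ← Real.exp_nat_mul]
        push_cast
        congr 1; ring
    _ ≤ 24 / (5 * r / 32) ^ 4 := hexp
    _ ≤ _ := by
        have : (5 * r / 32) ^ 4 = (5 / 32) ^ 4 * (N / 2) ^ 2 := by rw [← hr2]; ring
        rw [this, mul_one_div, div_le_div_iff₀ (by positivity) (by positivity)]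
        nlinarith

lemma krengel_sum (μ : Measure (ℤ → Bool)) (h : IsProductMeasure μ krengelMarginal) :
    ∑' n : ℤ, ∫⁻ x, ((μ.map (shiftZ n)).rnDeriv μ x) ^ (1 / 2 : ℝ) ∂μ ≠ ⊤ := by
  have hb : ∀ n : ℤ, ∫⁻ x, ((μ.map (shiftZ n)).rnDeriv μ x) ^ (1 / 2 : ℝ) ∂μ ≤
      ENNReal.ofReal (10 ^ 9 * (1 / ((|n| : ℝ) + 2) ^ 2)) := by
    intro n
    have ha := affinity_le h (shift_isProd h n) kM_pos (fun i b => kM_pos _ _)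
    by_cases hn : 12800 ≤ (|n| : ℝ)
    · obtain ⟨s, hs⟩ := aff_large n hn
      exact (ha s).trans (ENNReal.ofReal_le_ofReal hs)
    · refine (ha ∅).trans (ENNReal.ofReal_le_ofReal ?_)
      rw [Finset.prod_empty, mul_one_div, le_div_iff₀ (by positivity)]
      nlinarith [abs_nonneg (n : ℝ)]
  refine ne_top_of_le_ne_top ?_ (ENNReal.tsum_le_tsum hb)
  exact (sum_inv_sq.mul_left (10 ^ 9)).tsum_ofReal_ne_top

/-- The Bernoulli shift on `{0,1}^ℤ` with marginals `μ_i(0) = min(1/2, 10/√(|i|+2))` is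
non-atomic, nonsingular, and totally dissipative. -/
theorem krengel_shift_nonsingular_totally_dissipative
    (μ : Measure (ℤ → Bool)) (hprod : IsProductMeasure μ krengelMarginal) :
    (∀ x : ℤ → Bool, μ {x} = 0) ∧
    MeasEquiv (μ.map shift) μ ∧
    ∃ W : Set (ℤ → Bool), MeasurableSet W ∧
      (Pairwise fun m n : ℤ => Disjoint (shiftZ m '' W) (shiftZ n '' W)) ∧
      μ ((⋃ n : ℤ, shiftZ n '' W)ᶜ) = 0 := by

  have := prob_of_prod hprod
  refine ⟨krengel_nonatomic μ hprod, ⟨krengel_ac μ hprod 1, ?_⟩,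
    dissipative_of μ (krengel_ac μ hprod) (krengel_sum μ hprod)⟩
  have h1 := (krengel_ac μ hprod (-1)).map (shiftZ_meas 1)
  rw [Measure.map_map (shiftZ_meas 1) (shiftZ_meas (-1))] at h1
  have : (shiftZ 1 ∘ shiftZ (-1) : (ℤ → Bool) → (ℤ → Bool)) = id := by
    funext x
    rw [Function.comp, shiftZ_add]
    exact shiftZ_zero x
  rw [this, Measure.map_id] at h1
  exact h1
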